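/- The coordinate ring R₁₃/I_{C₂} of the C₂ cluster variety is a normal domain: it is an integral domain which is integrally closed in its field of fractions. -/

import Mathlib

/-!
The C₂ cluster variety.

`R13` is the polynomial ring over ℂ in the 13 variables, indexed as follows:
`0 ↦ θ₁, 1 ↦ θ₁₂, 2 ↦ θ₂, 3 ↦ θ₂₃, 4 ↦ θ₃, 5 ↦ θ₃₁,
 6 ↦ A₁, 7 ↦ A₁₂, 8 ↦ A₂, 9 ↦ A₂₃, 10 ↦ A₃, 11 ↦ A₃₁, 12 ↦ λ`.
Indices `i : Fin 3` stand for the (cyclic) indices 1,2,3, with `Fin 3` addition.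
-/

open MvPolynomial

noncomputable section

abbrev R13 : Type := MvPolynomial (Fin 13) ℂ

/-- The cluster variables θ₁, θ₂, θ₃. -/
def th : Fin 3 → R13 := ![X 0, X 2, X 4]

/-- The cluster variables θ₁₂, θ₂₃, θ₃₁ : `thp i = θ_{i,i+1}`. -/
def thp : Fin 3 → R13 := ![X 1, X 3, X 5]

/-- The coefficients A₁, A₂, A₃. -/
def aS : Fin 3 → R13 := ![X 6, X 8, X 10]

/-- The coefficients A₁₂, A₂₃, A₃₁ : `aP i = A_{i,i+1}`. -/
def aP : Fin 3 → R13 := ![X 7, X 9, X 11]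

/-- `A_{xy}` for *distinct* `x y : Fin 3` (unordered pair: `A_{xy} = A_{yx}`). -/
def aPP (x y : Fin 3) : R13 := aP (1 - x - y)

/-- The parameter λ. -/
def lam : R13 := X 12

/-- First family of relations: `θᵢθⱼ − A_{ij}θ_{ij} − A_{jk}A_kA_{ki}`,
for `(i,j,k)` a cyclic permutation of `(1,2,3)`. -/
def g1 (i : Fin 3) : R13 :=
  th i * th (i + 1) - aP i * thp i - aP (i + 1) * aS (i + 2) * aP (i + 2)

/-- Second family of relations: `θ_{ki}θ_{ij} − A_iθᵢ² − λA_{jk}θᵢ − A_jA_{jk}²A_k`. -/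
def g2 (i : Fin 3) : R13 :=
  thp (i + 2) * thp i - aS i * th i ^ 2 - lam * aP (i + 1) * th i
    - aS (i + 1) * aP (i + 1) ^ 2 * aS (i + 2)

/-- Third family of relations: `θᵢθ_{jk} − A_{ij}A_jθⱼ − λA_{ki}A_{ij} − A_kA_{ki}θ_k`. -/
def g3 (i : Fin 3) : R13 :=
  th i * thp (i + 1) - aP i * aS (i + 1) * th (i + 1) - lam * aP (i + 2) * aP i
    - aS (i + 2) * aP (i + 2) * th (i + 2)

/-- The C₂ cluster ideal, generated by the nine relations. -/
def IC2 : Ideal R13 :=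
  Ideal.span (Set.range g1 ∪ Set.range g2 ∪ Set.range g3)

/-- The nine generators of `IC2`, as a doubly-indexed family. -/
def genC2 : Fin 3 → Fin 3 → R13 := ![g1, g2, g3]

/-- The C₂ cluster variety `X_{C₂} ⊆ ℂ¹³`: the common zero locus of the nine generators. -/
def XC2 : Set (Fin 13 → ℂ) :=
  {p | ∀ i : Fin 3, eval p (g1 i) = 0 ∧ eval p (g2 i) = 0 ∧ eval p (g3 i) = 0}

/-- The condition that all six cluster coordinates θ vanish at `p`. -/
def thZero (p : Fin 13 → ℂ) : Prop :=
  ∀ i : Fin 3, eval p (th i) = 0 ∧ eval p (thp i) = 0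

end

/-- In an algebra satisfying the cluster relations, all monomials lie in every submodule that
contains the products of powers of `λ` with the cluster monomials. -/
lemma mono_mem {K A : Type*} [CommRing K] [CommRing A] [Algebra K A] (a1 a2 a3 b1 b2 b3 : K)
    (t1 t2 t3 p1 p2 p3 l : A)
    (h11 : t1 * t2 = b1 • p1 + (b2 * a3 * b3) • 1)
    (h12 : t2 * t3 = b2 • p2 + (b3 * a1 * b1) • 1)
    (h13 : t3 * t1 = b3 • p3 + (b1 * a2 * b2) • 1)
    (h21 : p3 * p1 = a1 • t1 ^ 2 + b2 • (l * t1) + (a2 * b2 ^ 2 * a3) • 1)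
    (h22 : p1 * p2 = a2 • t2 ^ 2 + b3 • (l * t2) + (a3 * b3 ^ 2 * a1) • 1)
    (h23 : p2 * p3 = a3 • t3 ^ 2 + b1 • (l * t3) + (a1 * b1 ^ 2 * a2) • 1)
    (h31 : t1 * p2 = (b1 * a2) • t2 + (b3 * b1) • l + (a3 * b3) • t3)
    (h32 : t2 * p3 = (b2 * a3) • t3 + (b1 * b2) • l + (a1 * b1) • t1)
    (h33 : t3 * p1 = (b3 * a1) • t1 + (b2 * b3) • l + (a2 * b2) • t2)
    (S : Submodule K A)
    (hS : ∀ x1 x2 x3 y1 y2 y3 k : ℕ, (x1 = 0 ∨ x2 = 0) → (x2 = 0 ∨ x3 = 0) → (x3 = 0 ∨ x1 = 0) →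
      (y3 = 0 ∨ y1 = 0) → (y1 = 0 ∨ y2 = 0) → (y2 = 0 ∨ y3 = 0) →
      (x1 = 0 ∨ y2 = 0) → (x2 = 0 ∨ y3 = 0) → (x3 = 0 ∨ y1 = 0) →
      t1 ^ x1 * t2 ^ x2 * t3 ^ x3 * p1 ^ y1 * p2 ^ y2 * p3 ^ y3 * l ^ k ∈ S)
    (n : ℕ) : ∀ x1 x2 x3 y1 y2 y3 k : ℕ, 2 * (x1 + x2 + x3) + 3 * (y1 + y2 + y3) ≤ n →
      t1 ^ x1 * t2 ^ x2 * t3 ^ x3 * p1 ^ y1 * p2 ^ y2 * p3 ^ y3 * l ^ k ∈ S := by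
  induction n using Nat.strong_induction_on with
  | _ n ih =>
  intro x1 x2 x3 y1 y2 y3 k hn
  have key2 : ∀ (u v q r m : A) (c d : K), u * v = c • q + d • r → q * m ∈ S → r * m ∈ S →
      (u * v) * m ∈ S := by
    intro u v q r m c d h hq hr
    rw [h, add_mul, smul_mul_assoc, smul_mul_assoc]
    exact S.add_mem (S.smul_mem _ hq) (S.smul_mem _ hr)
  have key3 : ∀ (u v q r s m : A) (c d e : K), u * v = c • q + d • r + e • s → q * m ∈ S →
      r * m ∈ S → s * m ∈ S → (u * v) * m ∈ S := by
    intro u v q r s m c d e h hq hr hs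
    rw [h, add_mul, add_mul, smul_mul_assoc, smul_mul_assoc, smul_mul_assoc]
    exact S.add_mem (S.add_mem (S.smul_mem _ hq) (S.smul_mem _ hr)) (S.smul_mem _ hs)
  have low : ∀ x1 x2 x3 y1 y2 y3 k : ℕ, 2 * (x1 + x2 + x3) + 3 * (y1 + y2 + y3) < n →
      t1 ^ x1 * t2 ^ x2 * t3 ^ x3 * p1 ^ y1 * p2 ^ y2 * p3 ^ y3 * l ^ k ∈ S :=
    fun x1 x2 x3 y1 y2 y3 k h => ih _ h x1 x2 x3 y1 y2 y3 k le_rfl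
  by_cases c11 : x1 = 0 ∨ x2 = 0
  swap
  · obtain ⟨x1, rfl⟩ : ∃ j, x1 = j + 1 := ⟨x1 - 1, by omega⟩
    obtain ⟨x2, rfl⟩ : ∃ j, x2 = j + 1 := ⟨x2 - 1, by omega⟩
    convert key2 _ _ _ _ (t1 ^ x1 * t2 ^ x2 * t3 ^ x3 * p1 ^ y1 * p2 ^ y2 * p3 ^ y3 * l ^ k)
      _ _ h11 ?_ ?_ using 1
    · ring
    · convert low x1 x2 x3 (y1 + 1) y2 y3 k (by omega) using 1; ring
    · convert low x1 x2 x3 y1 y2 y3 k (by omega) using 1; ring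
  by_cases c12 : x2 = 0 ∨ x3 = 0
  swap
  · obtain ⟨x2, rfl⟩ : ∃ j, x2 = j + 1 := ⟨x2 - 1, by omega⟩
    obtain ⟨x3, rfl⟩ : ∃ j, x3 = j + 1 := ⟨x3 - 1, by omega⟩
    convert key2 _ _ _ _ (t1 ^ x1 * t2 ^ x2 * t3 ^ x3 * p1 ^ y1 * p2 ^ y2 * p3 ^ y3 * l ^ k)
      _ _ h12 ?_ ?_ using 1
    · ring
    · convert low x1 x2 x3 y1 (y2 + 1) y3 k (by omega) using 1; ring
    · convert low x1 x2 x3 y1 y2 y3 k (by omega) using 1; ring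
  by_cases c13 : x3 = 0 ∨ x1 = 0
  swap
  · obtain ⟨x1, rfl⟩ : ∃ j, x1 = j + 1 := ⟨x1 - 1, by omega⟩
    obtain ⟨x3, rfl⟩ : ∃ j, x3 = j + 1 := ⟨x3 - 1, by omega⟩
    convert key2 _ _ _ _ (t1 ^ x1 * t2 ^ x2 * t3 ^ x3 * p1 ^ y1 * p2 ^ y2 * p3 ^ y3 * l ^ k)
      _ _ h13 ?_ ?_ using 1
    · ring
    · convert low x1 x2 x3 y1 y2 (y3 + 1) k (by omega) using 1; ring
    · convert low x1 x2 x3 y1 y2 y3 k (by omega) using 1; ring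
  by_cases c21 : y3 = 0 ∨ y1 = 0
  swap
  · obtain ⟨y1, rfl⟩ : ∃ j, y1 = j + 1 := ⟨y1 - 1, by omega⟩
    obtain ⟨y3, rfl⟩ : ∃ j, y3 = j + 1 := ⟨y3 - 1, by omega⟩
    convert key3 _ _ _ _ _ (t1 ^ x1 * t2 ^ x2 * t3 ^ x3 * p1 ^ y1 * p2 ^ y2 * p3 ^ y3 * l ^ k)
      _ _ _ h21 ?_ ?_ ?_ using 1
    · ring
    · convert low (x1 + 2) x2 x3 y1 y2 y3 k (by omega) using 1; ring
    · convert low (x1 + 1) x2 x3 y1 y2 y3 (k + 1) (by omega) using 1; ring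
    · convert low x1 x2 x3 y1 y2 y3 k (by omega) using 1; ring
  by_cases c22 : y1 = 0 ∨ y2 = 0
  swap
  · obtain ⟨y1, rfl⟩ : ∃ j, y1 = j + 1 := ⟨y1 - 1, by omega⟩
    obtain ⟨y2, rfl⟩ : ∃ j, y2 = j + 1 := ⟨y2 - 1, by omega⟩
    convert key3 _ _ _ _ _ (t1 ^ x1 * t2 ^ x2 * t3 ^ x3 * p1 ^ y1 * p2 ^ y2 * p3 ^ y3 * l ^ k)
      _ _ _ h22 ?_ ?_ ?_ using 1
    · ring
    · convert low x1 (x2 + 2) x3 y1 y2 y3 k (by omega) using 1; ring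
    · convert low x1 (x2 + 1) x3 y1 y2 y3 (k + 1) (by omega) using 1; ring
    · convert low x1 x2 x3 y1 y2 y3 k (by omega) using 1; ring
  by_cases c23 : y2 = 0 ∨ y3 = 0
  swap
  · obtain ⟨y2, rfl⟩ : ∃ j, y2 = j + 1 := ⟨y2 - 1, by omega⟩
    obtain ⟨y3, rfl⟩ : ∃ j, y3 = j + 1 := ⟨y3 - 1, by omega⟩
    convert key3 _ _ _ _ _ (t1 ^ x1 * t2 ^ x2 * t3 ^ x3 * p1 ^ y1 * p2 ^ y2 * p3 ^ y3 * l ^ k)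
      _ _ _ h23 ?_ ?_ ?_ using 1
    · ring
    · convert low x1 x2 (x3 + 2) y1 y2 y3 k (by omega) using 1; ring
    · convert low x1 x2 (x3 + 1) y1 y2 y3 (k + 1) (by omega) using 1; ring
    · convert low x1 x2 x3 y1 y2 y3 k (by omega) using 1; ring
  by_cases c31 : x1 = 0 ∨ y2 = 0
  swap
  · obtain ⟨x1, rfl⟩ : ∃ j, x1 = j + 1 := ⟨x1 - 1, by omega⟩
    obtain ⟨y2, rfl⟩ : ∃ j, y2 = j + 1 := ⟨y2 - 1, by omega⟩
    convert key3 _ _ _ _ _ (t1 ^ x1 * t2 ^ x2 * t3 ^ x3 * p1 ^ y1 * p2 ^ y2 * p3 ^ y3 * l ^ k)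
      _ _ _ h31 ?_ ?_ ?_ using 1
    · ring
    · convert low x1 (x2 + 1) x3 y1 y2 y3 k (by omega) using 1; ring
    · convert low x1 x2 x3 y1 y2 y3 (k + 1) (by omega) using 1; ring
    · convert low x1 x2 (x3 + 1) y1 y2 y3 k (by omega) using 1; ring
  by_cases c32 : x2 = 0 ∨ y3 = 0
  swap
  · obtain ⟨x2, rfl⟩ : ∃ j, x2 = j + 1 := ⟨x2 - 1, by omega⟩
    obtain ⟨y3, rfl⟩ : ∃ j, y3 = j + 1 := ⟨y3 - 1, by omega⟩
    convert key3 _ _ _ _ _ (t1 ^ x1 * t2 ^ x2 * t3 ^ x3 * p1 ^ y1 * p2 ^ y2 * p3 ^ y3 * l ^ k)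
      _ _ _ h32 ?_ ?_ ?_ using 1
    · ring
    · convert low x1 x2 (x3 + 1) y1 y2 y3 k (by omega) using 1; ring
    · convert low x1 x2 x3 y1 y2 y3 (k + 1) (by omega) using 1; ring
    · convert low (x1 + 1) x2 x3 y1 y2 y3 k (by omega) using 1; ring
  by_cases c33 : x3 = 0 ∨ y1 = 0
  swap
  · obtain ⟨x3, rfl⟩ : ∃ j, x3 = j + 1 := ⟨x3 - 1, by omega⟩
    obtain ⟨y1, rfl⟩ : ∃ j, y1 = j + 1 := ⟨y1 - 1, by omega⟩
    convert key3 _ _ _ _ _ (t1 ^ x1 * t2 ^ x2 * t3 ^ x3 * p1 ^ y1 * p2 ^ y2 * p3 ^ y3 * l ^ k)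
      _ _ _ h33 ?_ ?_ ?_ using 1
    · ring
    · convert low (x1 + 1) x2 x3 y1 y2 y3 k (by omega) using 1; ring
    · convert low x1 x2 x3 y1 y2 y3 (k + 1) (by omega) using 1; ring
    · convert low x1 (x2 + 1) x3 y1 y2 y3 k (by omega) using 1; ring
  exact hS _ _ _ _ _ _ _ c11 c12 c13 c21 c22 c23 c31 c32 c33

/-- A family of polynomials whose leading exponents are pairwise distinct is linearly independent. -/
lemma linearIndependent_of_degree_eq {σ F : Type*} [Field F] (m : MonomialOrder σ)
    (v : (σ →₀ ℕ) → MvPolynomial σ F) (hv : ∀ e, v e ≠ 0) (hd : ∀ e, m.degree (v e) = e) :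
    LinearIndependent F v := by
  classical
  rw [linearIndependent_iff]
  intro c hc
  by_contra hne
  obtain ⟨e, he, hmax⟩ := c.support.exists_max_image m.toSyn (Finsupp.support_nonempty_iff.mpr hne)
  have h := congrArg (coeff e) hc
  rw [Finsupp.linearCombination_apply, Finsupp.sum, coeff_sum, Finset.sum_eq_single e] at h
  · rw [coeff_smul, coeff_zero, smul_eq_mul, mul_eq_zero] at h
    rcases h with h | h
    · exact (Finsupp.mem_support_iff.mp he) h
    · have := (m.coeff_degree_eq_zero_iff (f := v e)).not.mpr (hv e)
      rw [hd] at this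
      exact this h
  · intro d hdm hde
    rw [coeff_smul, m.coeff_eq_zero_of_lt, smul_zero]
    rw [hd]
    exact lt_of_le_of_ne (hmax d hdm) (fun h => hde (m.toSyn.injective h))
  · intro h
    exact absurd he h

lemma degree_add_monomial {σ F : Type*} [Field F] (m : MonomialOrder σ) {f : MvPolynomial σ F}
    {e d : σ →₀ ℕ} (hf : m.degree f = e) (hd : d < e) (c : F) :
    m.degree (f + monomial d c) = e := by
  classical
  rw [m.degree_add_of_lt, hf]
  refine lt_of_le_of_lt (m.degree_monomial_le c) ?_
  rw [hf]
  exact m.toSyn_strictMono hd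

/-- The exponent vector with entries `x`, `y`, `z`. -/
noncomputable def expo (x y z : ℕ) : Fin 3 →₀ ℕ := Finsupp.equivFunOnFinite.symm ![x, y, z]

lemma expo_add (x y z x' y' z' : ℕ) :
    expo x y z + expo x' y' z' = expo (x + x') (y + y') (z + z') := by
  ext i; fin_cases i <;> simp [expo]

lemma nsmul_expo (n x y z : ℕ) : n • expo x y z = expo (n * x) (n * y) (n * z) := by
  ext i; fin_cases i <;> simp [expo]

lemma expo_eta (e : Fin 3 →₀ ℕ) : expo (e 0) (e 1) (e 2) = e := by
  ext i; fin_cases i <;> simp [expo]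

lemma expo_lt {x y z x' y' z' : ℕ} (h1 : x ≤ x') (h2 : y ≤ y') (h3 : z ≤ z')
    (h : x + y + z < x' + y' + z') : expo x y z < expo x' y' z' := by
  refine lt_of_le_of_ne ?_ ?_
  · intro i; fin_cases i <;> simp [expo] <;> omega
  · intro he
    have h0 := DFunLike.congr_fun he 0
    have h1 := DFunLike.congr_fun he 1
    have h2 := DFunLike.congr_fun he 2
    simp [expo] at h0 h1 h2
    omega

lemma degree_monomial_of_ne {σ F : Type*} [Field F] (m : MonomialOrder σ) (e : σ →₀ ℕ) {c : F}
    (hc : c ≠ 0) : m.degree (monomial e c) = e := by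
  classical
  rw [m.degree_monomial, if_neg hc]

lemma degree_mul_pow {σ F : Type*} [Field F] (m : MonomialOrder σ) {f g : MvPolynomial σ F}
    {d e : σ →₀ ℕ} (hf : f ≠ 0 ∧ m.degree f = d) (hg : g ≠ 0 ∧ m.degree g = e) (n : ℕ) :
    f * g ^ n ≠ 0 ∧ m.degree (f * g ^ n) = d + n • e :=
  ⟨mul_ne_zero hf.1 (pow_ne_zero _ hg.1), by
    rw [m.degree_mul hf.1 (pow_ne_zero _ hg.1), m.degree_pow, hf.2, hg.2]⟩

lemma ne_zero_of_degree {σ F : Type*} [Field F] (m : MonomialOrder σ) {f : MvPolynomial σ F}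
    {e : σ →₀ ℕ} (hf : m.degree f = e) (he : e ≠ 0) : f ≠ 0 ∧ m.degree f = e :=
  ⟨by rintro rfl; exact he (by rw [← hf, m.degree_zero]), hf⟩

/-- A domain is integrally closed if it is so away from the pairwise intersections of three divisors
`b i = 0` which pairwise form regular sequences. -/
lemma isIntegrallyClosed_of_regular {A : Type*} [CommRing A] [IsDomain A] (b : Fin 3 → A)
    (hb : ∀ i, b i ≠ 0)
    (hreg : ∀ i j, i ≠ j → ∀ u v : A, ∀ m n : ℕ, b i ^ m * u = b j ^ n * v → b j ^ n ∣ u)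
    (hloc : ∀ i, ∀ f : FractionRing A, IsIntegral A f → ∃ (n : ℕ) (u : A),
      algebraMap A (FractionRing A) ((b i * b (i + 1)) ^ n) * f = algebraMap A _ u) :
    IsIntegrallyClosed A := by
  rw [isIntegrallyClosed_iff (FractionRing A)]
  intro f hf
  have inj := IsFractionRing.injective A (FractionRing A)
  have glue : ∀ i j, i ≠ j → ∀ g : FractionRing A, ∀ m n : ℕ, ∀ u v : A,
      algebraMap A _ (b i ^ m) * g = algebraMap A _ u →
      algebraMap A _ (b j ^ n) * g = algebraMap A _ v → ∃ w, algebraMap A _ w = g := by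
    intro i j hij g m n u v hu hv
    have : b i ^ m * v = b j ^ n * u := by
      apply inj
      rw [map_mul, map_mul, ← hu, ← hv]; ring
    obtain ⟨w, rfl⟩ := hreg i j hij _ _ _ _ this
    refine ⟨w, ?_⟩
    have h0 : algebraMap A (FractionRing A) (b j ^ n) ≠ 0 := by
      rw [map_ne_zero_iff _ inj]; exact pow_ne_zero _ (hb j)
    rw [map_mul] at hv
    exact (mul_left_cancel₀ h0 hv).symm
  obtain ⟨n0, u0, h0⟩ := hloc 0 f hf
  obtain ⟨n1, u1, h1⟩ := hloc 1 f hf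
  obtain ⟨n2, u2, h2⟩ := hloc 2 f hf
  simp only [Fin.isValue, zero_add, Fin.reduceAdd, map_mul, mul_pow] at h0 h1 h2
  obtain ⟨w1, hw1⟩ := glue 0 2 (by decide) (algebraMap A _ (b 1 ^ (n0 + n1)) * f) n0 n1
    (b 1 ^ n1 * u0) (b 1 ^ n0 * u1)
    (by rw [map_mul, ← h0, pow_add]; simp only [map_mul]; ring)
    (by rw [map_mul, ← h1, pow_add]; simp only [map_mul]; ring)
  obtain ⟨w0, hw0⟩ := glue 1 2 (by decide) (algebraMap A _ (b 0 ^ (n0 + n2)) * f) n0 n2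
    (b 0 ^ n2 * u0) (b 0 ^ n0 * u2)
    (by rw [map_mul, ← h0, pow_add]; simp only [map_mul]; ring)
    (by rw [map_mul, ← h2, pow_add]; simp only [map_mul]; ring)
  exact glue 0 1 (by decide) f _ _ w0 w1 hw0.symm hw1.symm

open Polynomial in
/-- If `A` agrees with an integrally closed subring `C` away from `x`, then every element integral
over `A` becomes an element of `A` after multiplication by a power of `x`. -/
lemma exists_multiple_mem {A C : Type*} [CommRing A] [IsDomain A] [CommRing C] [IsDomain C]
    [IsIntegrallyClosed C] (γ : C →+* A) (hγ : Function.Injective γ) (x : C) (hx : x ≠ 0)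
    (hsurj : ∀ z : A, ∃ (n : ℕ) (c : C), γ x ^ n * z = γ c)
    (f : FractionRing A) (hf : IsIntegral A f) :
    ∃ (n : ℕ) (u : A), algebraMap A (FractionRing A) (γ x ^ n) * f = algebraMap A _ u := by
  have inj := IsFractionRing.injective A (FractionRing A)
  obtain ⟨P, hP, hPf⟩ := hf
  -- a common exponent for the coefficients
  have hN : ∃ N : ℕ, ∀ i ∈ Finset.range (P.natDegree + 1), ∃ c, γ x ^ N * P.coeff i = γ c := by
    choose n c hc using hsurj
    refine ⟨∑ i ∈ Finset.range (P.natDegree + 1), n (P.coeff i), fun i hi => ?_⟩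
    obtain ⟨k, hk⟩ := Nat.exists_eq_add_of_le
      (Finset.single_le_sum (f := fun i => n (P.coeff i)) (fun _ _ => Nat.zero_le _) hi)
    refine ⟨x ^ k * c (P.coeff i), ?_⟩
    rw [hk, pow_add, map_mul, ← hc, map_pow]; ring
  obtain ⟨N, hN⟩ := hN
  set Q := P.scaleRoots (γ x ^ N) with hQ
  have hQm : Q.Monic := (Polynomial.monic_scaleRoots_iff _).mpr hP
  have hQl : Q ∈ Polynomial.lifts γ := by
    rw [Polynomial.lifts_iff_coeff_lifts]
    intro i
    rw [hQ, coeff_scaleRoots]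
    rcases lt_trichotomy i P.natDegree with h | h | h
    · obtain ⟨c, hc⟩ := hN i (Finset.mem_range.mpr (by omega))
      obtain ⟨k, hk⟩ : ∃ k, P.natDegree - i = k + 1 := ⟨P.natDegree - i - 1, by omega⟩
      refine ⟨c * (x ^ N) ^ k, ?_⟩
      rw [hk, map_mul, ← hc, map_pow, map_pow]; ring
    · subst h
      exact ⟨1, by simp [hP.coeff_natDegree]⟩
    · exact ⟨0, by rw [coeff_eq_zero_of_natDegree_lt h]; simp⟩
  obtain ⟨T, hT, -, hTm⟩ := Polynomial.lifts_and_natDegree_eq_and_monic hQl hQm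
  have hroot : Q.eval₂ (algebraMap A (FractionRing A)) (algebraMap A _ (γ x ^ N) * f) = 0 :=
    scaleRoots_eval₂_eq_zero _ hPf
  -- the fraction field of `C` is that of `A`
  let _ : Algebra C (FractionRing A) := ((algebraMap A (FractionRing A)).comp γ).toAlgebra
  have hmap : ∀ c : C, algebraMap C (FractionRing A) c = algebraMap A _ (γ c) := fun _ => rfl
  have injC : Function.Injective (algebraMap C (FractionRing A)) := inj.comp hγ
  have hx' : ∀ n : ℕ, algebraMap A (FractionRing A) (γ x ^ n) ≠ 0 := fun n => by
    rw [← map_pow, ← hmap, map_ne_zero_iff _ injC]; exact pow_ne_zero _ hx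
  have : FaithfulSMul C (FractionRing A) := (faithfulSMul_iff_algebraMap_injective _ _).mpr injC
  have : IsFractionRing C (FractionRing A) := by
    refine IsFractionRing.of_field C (FractionRing A) fun z => ?_
    obtain ⟨u, v, hv, rfl⟩ := IsFractionRing.div_surjective (A := A) z
    obtain ⟨n, c, hc⟩ := hsurj u
    obtain ⟨m, d, hd⟩ := hsurj v
    refine ⟨x ^ m * c, x ^ n * d, ?_⟩
    rw [hmap, hmap, map_mul γ, map_mul γ, ← hc, ← hd, map_pow γ, map_pow γ]
    have hv0 : algebraMap A (FractionRing A) v ≠ 0 := by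
      rw [map_ne_zero_iff _ inj]; exact nonZeroDivisors.ne_zero hv
    have h1 := hx' n
    have h2 := hx' m
    simp only [map_mul]
    field_simp
  have hint : IsIntegral C (algebraMap A (FractionRing A) (γ x ^ N) * f) := by
    refine ⟨T, hTm, ?_⟩
    rw [← hT, Polynomial.eval₂_map] at hroot
    exact hroot
  obtain ⟨y, hy⟩ := (isIntegrallyClosed_iff (FractionRing A)).mp ‹IsIntegrallyClosed C› hint
  exact ⟨N, γ y, hy.symm⟩

/-- A point of the variety with values in a `ℂ`-algebra induces a map out of the coordinate ring. -/
lemma aeval_eq_zero_of_mem {B : Type*} [CommRing B] [Algebra ℂ B]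
    (t1 t2 t3 p1 p2 p3 a1 a2 a3 b1 b2 b3 l : B)
    (h11 : t1 * t2 = b1 * p1 + b2 * a3 * b3)
    (h12 : t2 * t3 = b2 * p2 + b3 * a1 * b1)
    (h13 : t3 * t1 = b3 * p3 + b1 * a2 * b2)
    (h21 : p3 * p1 = a1 * t1 ^ 2 + l * b2 * t1 + a2 * b2 ^ 2 * a3)
    (h22 : p1 * p2 = a2 * t2 ^ 2 + l * b3 * t2 + a3 * b3 ^ 2 * a1)
    (h23 : p2 * p3 = a3 * t3 ^ 2 + l * b1 * t3 + a1 * b1 ^ 2 * a2)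
    (h31 : t1 * p2 = b1 * a2 * t2 + l * b3 * b1 + a3 * b3 * t3)
    (h32 : t2 * p3 = b2 * a3 * t3 + l * b1 * b2 + a1 * b1 * t1)
    (h33 : t3 * p1 = b3 * a1 * t1 + l * b2 * b3 + a2 * b2 * t2)
    (f : R13) (hf : f ∈ IC2) :
    aeval (R := ℂ) ![t1, p1, t2, p2, t3, p3, a1, b1, a2, b2, a3, b3, l] f = 0 := by
  suffices h : IC2 ≤ RingHom.ker (aeval (R := ℂ)
      ![t1, p1, t2, p2, t3, p3, a1, b1, a2, b2, a3, b3, l]) from h hf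
  rw [IC2, Ideal.span_le]
  rintro _ ((⟨i, rfl⟩ | ⟨i, rfl⟩) | ⟨i, rfl⟩) <;>
  rw [SetLike.mem_coe, RingHom.mem_ker] <;>
  fin_cases i <;>
  simp [g1, g2, g3, th, thp, aS, aP, lam]
  · linear_combination h11
  · linear_combination h12
  · linear_combination h13
  · linear_combination h21
  · linear_combination h22
  · linear_combination h23
  · linear_combination h31
  · linear_combination h32
  · linear_combination h33

/-- The coordinate ring of the `C₂` cluster variety. -/
def CoordRing : Type := R13 ⧸ IC2

noncomputable instance : CommRing CoordRing := inferInstanceAs (CommRing (R13 ⧸ IC2))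

noncomputable instance : Algebra ℂ CoordRing := inferInstanceAs (Algebra ℂ (R13 ⧸ IC2))

/-- Restriction of polynomial functions to the variety. -/
noncomputable def restr : R13 →ₐ[ℂ] CoordRing := Ideal.Quotient.mkₐ ℂ IC2

lemma restr_surjective : Function.Surjective restr := Ideal.Quotient.mk_surjective

lemma restr_eq_zero_iff {f : R13} : restr f = 0 ↔ f ∈ IC2 := Ideal.Quotient.eq_zero_iff_mem

/-- The coordinate functions on the variety. -/
noncomputable def cf (i : Fin 13) : CoordRing := restr (X i)

lemma rel1 (i : Fin 3) : restr (g1 i) = 0 :=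
  restr_eq_zero_iff.mpr
    (Ideal.subset_span (Or.inl (Or.inl ⟨i, rfl⟩)))

lemma rel2 (i : Fin 3) : restr (g2 i) = 0 :=
  restr_eq_zero_iff.mpr
    (Ideal.subset_span (Or.inl (Or.inr ⟨i, rfl⟩)))

lemma rel3 (i : Fin 3) : restr (g3 i) = 0 :=
  restr_eq_zero_iff.mpr
    (Ideal.subset_span (Or.inr ⟨i, rfl⟩))

lemma cf_rel11 : cf 0 * cf 2 = cf 7 * cf 1 + cf 9 * cf 10 * cf 11 := by
  have h := rel1 0
  simp [g1, th, thp, aS, aP] at h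
  simp only [cf]; linear_combination h

lemma cf_rel12 : cf 2 * cf 4 = cf 9 * cf 3 + cf 11 * cf 6 * cf 7 := by
  have h := rel1 1
  simp [g1, th, thp, aS, aP] at h
  simp only [cf]; linear_combination h

lemma cf_rel13 : cf 4 * cf 0 = cf 11 * cf 5 + cf 7 * cf 8 * cf 9 := by
  have h := rel1 2
  simp [g1, th, thp, aS, aP] at h
  simp only [cf]; linear_combination h

lemma cf_rel21 : cf 5 * cf 1 =
    cf 6 * cf 0 ^ 2 + cf 12 * cf 9 * cf 0 + cf 8 * cf 9 ^ 2 * cf 10 := by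
  have h := rel2 0
  simp [g2, th, thp, aS, aP, lam] at h
  simp only [cf]; linear_combination h

lemma cf_rel22 : cf 1 * cf 3 =
    cf 8 * cf 2 ^ 2 + cf 12 * cf 11 * cf 2 + cf 10 * cf 11 ^ 2 * cf 6 := by
  have h := rel2 1
  simp [g2, th, thp, aS, aP, lam] at h
  simp only [cf]; linear_combination h

lemma cf_rel23 : cf 3 * cf 5 =
    cf 10 * cf 4 ^ 2 + cf 12 * cf 7 * cf 4 + cf 6 * cf 7 ^ 2 * cf 8 := by
  have h := rel2 2
  simp [g2, th, thp, aS, aP, lam] at h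
  simp only [cf]; linear_combination h

lemma cf_rel31 : cf 0 * cf 3 =
    cf 7 * cf 8 * cf 2 + cf 12 * cf 11 * cf 7 + cf 10 * cf 11 * cf 4 := by
  have h := rel3 0
  simp [g3, th, thp, aS, aP, lam] at h
  simp only [cf]; linear_combination h

lemma cf_rel32 : cf 2 * cf 5 =
    cf 9 * cf 10 * cf 4 + cf 12 * cf 7 * cf 9 + cf 6 * cf 7 * cf 0 := by
  have h := rel3 1
  simp [g3, th, thp, aS, aP, lam] at h
  simp only [cf]; linear_combination h

lemma cf_rel33 : cf 4 * cf 1 =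
    cf 11 * cf 6 * cf 0 + cf 12 * cf 9 * cf 11 + cf 8 * cf 9 * cf 2 := by
  have h := rel3 2
  simp [g3, th, thp, aS, aP, lam] at h
  simp only [cf]; linear_combination h

lemma coordRing_induction {p : CoordRing → Prop} (hC : ∀ c : ℂ, p (algebraMap ℂ _ c))
    (hadd : ∀ u v, p u → p v → p (u + v)) (hmul : ∀ u i, p u → p (u * cf i)) (z : CoordRing) :
    p z := by
  obtain ⟨f, rfl⟩ := restr_surjective z
  induction f using MvPolynomial.induction_on with
  | C c => rw [← algebraMap_eq, AlgHom.commutes]; exact hC c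
  | add u v hu hv => rw [map_add]; exact hadd _ _ hu hv
  | mul_X u i hu => rw [map_mul]; exact hmul _ i hu

/-- The coefficient ring, in the variables `A₁, A₂, A₃, A₁₂, A₂₃, A₃₁`. -/
abbrev CoeffRing : Type := MvPolynomial (Fin 6) ℂ

/-- The structure map of the coordinate ring over the coefficient ring. -/
noncomputable def coeffHom : CoeffRing →ₐ[ℂ] CoordRing :=
  aeval ![cf 6, cf 8, cf 10, cf 7, cf 9, cf 11]

noncomputable instance coeffAlgebra : Algebra CoeffRing CoordRing :=
  (coeffHom : CoeffRing →+* CoordRing).toAlgebra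

lemma coeff_smul_def (k : CoeffRing) (z : CoordRing) : k • z = coeffHom k * z := rfl

/-- The element of the basis with exponent vector `e`: a monomial in `λ` times a cluster monomial. -/
noncomputable def stdMon (e : Fin 3 →₀ ℕ) : CoordRing :=
  let k := min (e 0) (min (e 1) (e 2))
  let y1 := min (e 0) (e 1) - k
  let y2 := min (e 1) (e 2) - k
  let y3 := min (e 2) (e 0) - k
  cf 0 ^ (e 0 - k - y1 - y3) * cf 2 ^ (e 1 - k - y1 - y2) * cf 4 ^ (e 2 - k - y2 - y3) *
    cf 1 ^ y1 * cf 3 ^ y2 * cf 5 ^ y3 * cf 12 ^ k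

lemma stdMon_expo (x1 x2 x3 y1 y2 y3 k : ℕ) (c1 : x1 = 0 ∨ x2 = 0) (c2 : x2 = 0 ∨ x3 = 0)
    (c3 : x3 = 0 ∨ x1 = 0) (c4 : y3 = 0 ∨ y1 = 0) (c5 : y1 = 0 ∨ y2 = 0) (c6 : y2 = 0 ∨ y3 = 0)
    (c7 : x1 = 0 ∨ y2 = 0) (c8 : x2 = 0 ∨ y3 = 0) (c9 : x3 = 0 ∨ y1 = 0) :
    stdMon (expo (x1 + y1 + y3 + k) (x2 + y1 + y2 + k) (x3 + y2 + y3 + k)) =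
      cf 0 ^ x1 * cf 2 ^ x2 * cf 4 ^ x3 * cf 1 ^ y1 * cf 3 ^ y2 * cf 5 ^ y3 * cf 12 ^ k := by
  have hk : min (x1 + y1 + y3 + k) (min (x2 + y1 + y2 + k) (x3 + y2 + y3 + k)) = k := by omega
  have h1 : min (x1 + y1 + y3 + k) (x2 + y1 + y2 + k) - k = y1 := by omega
  have h2 : min (x2 + y1 + y2 + k) (x3 + y2 + y3 + k) - k = y2 := by omega
  have h3 : min (x3 + y2 + y3 + k) (x1 + y1 + y3 + k) - k = y3 := by omega
  have h4 : x1 + y1 + y3 + k - k - y1 - y3 = x1 := by omega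
  have h5 : x2 + y1 + y2 + k - k - y1 - y2 = x2 := by omega
  have h6 : x3 + y2 + y3 + k - k - y2 - y3 = x3 := by omega
  simp only [stdMon, expo, Finsupp.equivFunOnFinite_symm_apply_apply, Matrix.cons_val,
    hk, h1, h2, h3, h4, h5, h6]

lemma span_stdMon : Submodule.span CoeffRing (Set.range stdMon) = ⊤ := by
  have hmon := mono_mem (K := CoeffRing) (A := CoordRing) (X 0) (X 1) (X 2) (X 3) (X 4) (X 5)
    (cf 0) (cf 2) (cf 4) (cf 1) (cf 3) (cf 5) (cf 12)
    (by simp [coeff_smul_def, coeffHom]; linear_combination cf_rel11)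
    (by simp [coeff_smul_def, coeffHom]; linear_combination cf_rel12)
    (by simp [coeff_smul_def, coeffHom]; linear_combination cf_rel13)
    (by simp [coeff_smul_def, coeffHom]; linear_combination cf_rel21)
    (by simp [coeff_smul_def, coeffHom]; linear_combination cf_rel22)
    (by simp [coeff_smul_def, coeffHom]; linear_combination cf_rel23)
    (by simp [coeff_smul_def, coeffHom]; linear_combination cf_rel31)
    (by simp [coeff_smul_def, coeffHom]; linear_combination cf_rel32)
    (by simp [coeff_smul_def, coeffHom]; linear_combination cf_rel33)
    (Submodule.span CoeffRing (Set.range stdMon))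
    (by
      intro x1 x2 x3 y1 y2 y3 k c1 c2 c3 c4 c5 c6 c7 c8 c9
      rw [← stdMon_expo x1 x2 x3 y1 y2 y3 k c1 c2 c3 c4 c5 c6 c7 c8 c9]
      exact Submodule.subset_span ⟨_, rfl⟩)
  have hmon' := fun x1 x2 x3 y1 y2 y3 k => hmon _ x1 x2 x3 y1 y2 y3 k le_rfl
  -- the span of all monomials is closed under multiplication by the coordinate functions
  have hclosed : ∀ (w : CoordRing), (∀ x1 x2 x3 y1 y2 y3 k : ℕ,
      cf 0 ^ x1 * cf 2 ^ x2 * cf 4 ^ x3 * cf 1 ^ y1 * cf 3 ^ y2 * cf 5 ^ y3 * cf 12 ^ k * w ∈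
        Submodule.span CoeffRing (Set.range stdMon)) →
      ∀ u ∈ Submodule.span CoeffRing (Set.range stdMon),
        u * w ∈ Submodule.span CoeffRing (Set.range stdMon) := by
    intro w hw u hu
    induction hu using Submodule.span_induction with
    | mem u hu => obtain ⟨e, rfl⟩ := hu; exact hw _ _ _ _ _ _ _
    | zero => rw [zero_mul]; exact Submodule.zero_mem _
    | add u v _ _ hu hv => rw [add_mul]; exact Submodule.add_mem _ hu hv
    | smul c u _ hu => rw [smul_mul_assoc]; exact Submodule.smul_mem _ c hu
  have hcoeff : ∀ (k : CoeffRing), ∀ u ∈ Submodule.span CoeffRing (Set.range stdMon),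
      u * coeffHom k ∈ Submodule.span CoeffRing (Set.range stdMon) := by
    intro k u hu
    rw [mul_comm, ← coeff_smul_def]
    exact Submodule.smul_mem _ k hu
  rw [eq_top_iff]
  rintro z -
  induction z using coordRing_induction with
  | hC c =>
    have h := Submodule.smul_mem _ (algebraMap ℂ CoeffRing c) (hmon' 0 0 0 0 0 0 0)
    rw [coeff_smul_def, AlgHom.commutes] at h
    simpa using h
  | hadd u v hu hv => exact Submodule.add_mem _ hu hv
  | hmul u i hu =>
    fin_cases i
    · refine hclosed _ (fun x1 x2 x3 y1 y2 y3 k => ?_) u hu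
      convert hmon' (x1 + 1) x2 x3 y1 y2 y3 k using 1; simp; ring
    · refine hclosed _ (fun x1 x2 x3 y1 y2 y3 k => ?_) u hu
      convert hmon' x1 x2 x3 (y1 + 1) y2 y3 k using 1; simp; ring
    · refine hclosed _ (fun x1 x2 x3 y1 y2 y3 k => ?_) u hu
      convert hmon' x1 (x2 + 1) x3 y1 y2 y3 k using 1; simp; ring
    · refine hclosed _ (fun x1 x2 x3 y1 y2 y3 k => ?_) u hu
      convert hmon' x1 x2 x3 y1 (y2 + 1) y3 k using 1; simp; ring
    · refine hclosed _ (fun x1 x2 x3 y1 y2 y3 k => ?_) u hu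
      convert hmon' x1 x2 (x3 + 1) y1 y2 y3 k using 1; simp; ring
    · refine hclosed _ (fun x1 x2 x3 y1 y2 y3 k => ?_) u hu
      convert hmon' x1 x2 x3 y1 y2 (y3 + 1) k using 1; simp; ring
    · simpa [coeffHom] using hcoeff (X 0) u hu
    · simpa [coeffHom] using hcoeff (X 3) u hu
    · simpa [coeffHom] using hcoeff (X 1) u hu
    · simpa [coeffHom] using hcoeff (X 4) u hu
    · simpa [coeffHom] using hcoeff (X 2) u hu
    · simpa [coeffHom] using hcoeff (X 5) u hu
    · refine hclosed _ (fun x1 x2 x3 y1 y2 y3 k => ?_) u hu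
      convert hmon' x1 x2 x3 y1 y2 y3 (k + 1) using 1; simp; ring

/-- A map from the coordinate ring to a domain, given by a point at which `A₁₂`, `A₂₃`, `A₃₁`
do not vanish; there the variety is a family of cubic hypersurfaces. -/
noncomputable def pointHom {B : Type*} [CommRing B] [IsDomain B] [Algebra ℂ B]
    (t1 t2 t3 p1 p2 p3 a1 a2 a3 b1 b2 b3 l : B) (hb1 : b1 ≠ 0) (hb2 : b2 ≠ 0) (hb3 : b3 ≠ 0)
    (h1 : b1 * p1 = t1 * t2 - a3 * b2 * b3)
    (h2 : b2 * p2 = t2 * t3 - a1 * b3 * b1)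
    (h3 : b3 * p3 = t3 * t1 - a2 * b1 * b2)
    (hl : b1 * b2 * b3 * l =
      t1 * t2 * t3 - a1 * b3 * b1 * t1 - a2 * b1 * b2 * t2 - a3 * b2 * b3 * t3) :
    CoordRing →ₐ[ℂ] B :=
  Ideal.Quotient.liftₐ IC2 (aeval ![t1, p1, t2, p2, t3, p3, a1, b1, a2, b2, a3, b3, l])
    (aeval_eq_zero_of_mem t1 t2 t3 p1 p2 p3 a1 a2 a3 b1 b2 b3 l
      (by linear_combination -h1) (by linear_combination -h2) (by linear_combination -h3)
      (mul_left_cancel₀ (mul_ne_zero hb3 hb1) (by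
        linear_combination (b3 * p3) * h1 + (t1 * t2 - a3 * b2 * b3) * h3 - t1 * hl))
      (mul_left_cancel₀ (mul_ne_zero hb1 hb2) (by
        linear_combination (b1 * p1) * h2 + (t2 * t3 - a1 * b3 * b1) * h1 - t2 * hl))
      (mul_left_cancel₀ (mul_ne_zero hb2 hb3) (by
        linear_combination (b2 * p2) * h3 + (t3 * t1 - a2 * b1 * b2) * h2 - t3 * hl))
      (mul_left_cancel₀ hb2 (by linear_combination t1 * h2 - hl))
      (mul_left_cancel₀ hb3 (by linear_combination t2 * h3 - hl))
      (mul_left_cancel₀ hb1 (by linear_combination t3 * h1 - hl)))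

lemma pointHom_cf {B : Type*} [CommRing B] [IsDomain B] [Algebra ℂ B]
    (t1 t2 t3 p1 p2 p3 a1 a2 a3 b1 b2 b3 l : B) (hb1 : b1 ≠ 0) (hb2 : b2 ≠ 0) (hb3 : b3 ≠ 0)
    (h1 : b1 * p1 = t1 * t2 - a3 * b2 * b3)
    (h2 : b2 * p2 = t2 * t3 - a1 * b3 * b1)
    (h3 : b3 * p3 = t3 * t1 - a2 * b1 * b2)
    (hl : b1 * b2 * b3 * l =
      t1 * t2 * t3 - a1 * b3 * b1 * t1 - a2 * b1 * b2 * t2 - a3 * b2 * b3 * t3) (i : Fin 13) :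
    pointHom t1 t2 t3 p1 p2 p3 a1 a2 a3 b1 b2 b3 l hb1 hb2 hb3 h1 h2 h3 hl (cf i) =
      ![t1, p1, t2, p2, t3, p3, a1, b1, a2, b2, a3, b3, l] i :=
  aeval_X _ i

/-- The field of rational functions in the coefficients. -/
abbrev CoeffField : Type := FractionRing CoeffRing

/-- The coefficients as rational functions. -/
noncomputable def cc (i : Fin 6) : CoeffField := algebraMap CoeffRing CoeffField (X i)

lemma cc_ne_zero (i : Fin 6) : cc i ≠ 0 := by
  rw [cc, map_ne_zero_iff _ (IsFractionRing.injective CoeffRing CoeffField)]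
  exact X_ne_zero i

/-- The generic cubic chart: the coordinate functions expressed through `θ₁`, `θ₂`, `θ₃` and the
coefficients. -/
noncomputable def chart : CoordRing →ₐ[ℂ] MvPolynomial (Fin 3) CoeffField :=
  pointHom (monomial (expo 1 0 0) 1) (monomial (expo 0 1 0) 1) (monomial (expo 0 0 1) 1)
    (monomial (expo 1 1 0) (cc 3)⁻¹ + monomial (expo 0 0 0) (-(cc 2 * cc 4 * cc 5 / cc 3)))
    (monomial (expo 0 1 1) (cc 4)⁻¹ + monomial (expo 0 0 0) (-(cc 0 * cc 5 * cc 3 / cc 4)))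
    (monomial (expo 1 0 1) (cc 5)⁻¹ + monomial (expo 0 0 0) (-(cc 1 * cc 3 * cc 4 / cc 5)))
    (monomial (expo 0 0 0) (cc 0)) (monomial (expo 0 0 0) (cc 1)) (monomial (expo 0 0 0) (cc 2))
    (monomial (expo 0 0 0) (cc 3)) (monomial (expo 0 0 0) (cc 4)) (monomial (expo 0 0 0) (cc 5))
    (monomial (expo 1 1 1) (cc 3 * cc 4 * cc 5)⁻¹ + monomial (expo 1 0 0) (-(cc 0 / cc 4)) +
      monomial (expo 0 1 0) (-(cc 1 / cc 5)) + monomial (expo 0 0 1) (-(cc 2 / cc 3)))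
    (by simp [cc_ne_zero]) (by simp [cc_ne_zero]) (by simp [cc_ne_zero])
    (by
      have h := cc_ne_zero 3
      have e0 : cc 3 * (cc 3)⁻¹ = 1 := by field_simp
      have e1 : cc 3 * -(cc 2 * cc 4 * cc 5 / cc 3) = -(cc 2 * cc 4 * cc 5) := by field_simp
      simp only [mul_add, monomial_mul, expo_add, e0, e1, sub_eq_add_neg, ← map_neg (monomial _),
        add_zero, zero_add, mul_one])
    (by
      have h := cc_ne_zero 4
      have e0 : cc 4 * (cc 4)⁻¹ = 1 := by field_simp
      have e1 : cc 4 * -(cc 0 * cc 5 * cc 3 / cc 4) = -(cc 0 * cc 5 * cc 3) := by field_simp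
      simp only [mul_add, monomial_mul, expo_add, e0, e1, sub_eq_add_neg, ← map_neg (monomial _),
        add_zero, zero_add, mul_one])
    (by
      have h := cc_ne_zero 5
      have e0 : cc 5 * (cc 5)⁻¹ = 1 := by field_simp
      have e1 : cc 5 * -(cc 1 * cc 3 * cc 4 / cc 5) = -(cc 1 * cc 3 * cc 4) := by field_simp
      simp only [mul_add, monomial_mul, expo_add, e0, e1, sub_eq_add_neg, ← map_neg (monomial _),
        add_zero, zero_add, mul_one])
    (by
      have h3 := cc_ne_zero 3
      have h4 := cc_ne_zero 4
      have h5 := cc_ne_zero 5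
      have e0 : cc 3 * cc 4 * cc 5 * -(cc 0 / cc 4) = -(cc 0 * cc 5 * cc 3) := by field_simp
      have e1 : cc 3 * cc 4 * cc 5 * -(cc 1 / cc 5) = -(cc 1 * cc 3 * cc 4) := by field_simp
      have e2 : cc 3 * cc 4 * cc 5 * -(cc 2 / cc 3) = -(cc 2 * cc 4 * cc 5) := by field_simp
      have e3 : cc 3 * cc 4 * cc 5 * (cc 3 * cc 4 * cc 5)⁻¹ = 1 := by field_simp
      simp only [mul_add, monomial_mul, expo_add, e0, e1, e2, e3, sub_eq_add_neg,
        ← map_neg (monomial _),         add_zero, zero_add, mul_one])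

lemma chart_cf (i : Fin 13) : chart (cf i) =
    ![(monomial (expo 1 0 0) 1),
    (monomial (expo 1 1 0) (cc 3)⁻¹ + monomial (expo 0 0 0) (-(cc 2 * cc 4 * cc 5 / cc 3))),
    (monomial (expo 0 1 0) 1),
    (monomial (expo 0 1 1) (cc 4)⁻¹ + monomial (expo 0 0 0) (-(cc 0 * cc 5 * cc 3 / cc 4))),
    (monomial (expo 0 0 1) 1),
    (monomial (expo 1 0 1) (cc 5)⁻¹ + monomial (expo 0 0 0) (-(cc 1 * cc 3 * cc 4 / cc 5))),
    (monomial (expo 0 0 0) (cc 0)), (monomial (expo 0 0 0) (cc 3)), (monomial (expo 0 0 0) (cc 1)),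
    (monomial (expo 0 0 0) (cc 4)), (monomial (expo 0 0 0) (cc 2)), (monomial (expo 0 0 0) (cc 5)),
    (monomial (expo 1 1 1) (cc 3 * cc 4 * cc 5)⁻¹ + monomial (expo 1 0 0) (-(cc 0 / cc 4)) +
      monomial (expo 0 1 0) (-(cc 1 / cc 5)) + monomial (expo 0 0 1) (-(cc 2 / cc 3)))] i :=
  pointHom_cf ..

lemma expo_zero : expo 0 0 0 = 0 := by
  ext i; fin_cases i <;> simp [expo]

lemma expo_ne_zero {x y z : ℕ} (h : 0 < x + y + z) : expo x y z ≠ 0 := by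
  rw [← expo_zero]
  exact (expo_lt (Nat.zero_le _) (Nat.zero_le _) (Nat.zero_le _) h).ne'

lemma chart_stdMon (e : Fin 3 →₀ ℕ) : chart (stdMon e) ≠ 0 ∧
    MonomialOrder.lex.degree (chart (stdMon e)) = e := by
  have h0 := ne_zero_of_degree MonomialOrder.lex (f := chart (cf 0)) (e := expo 1 0 0)
    (by simpa [chart_cf] using degree_monomial_of_ne MonomialOrder.lex (expo 1 0 0) one_ne_zero)
    (expo_ne_zero (by omega))
  have h2 := ne_zero_of_degree MonomialOrder.lex (f := chart (cf 2)) (e := expo 0 1 0)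
    (by simpa [chart_cf] using degree_monomial_of_ne MonomialOrder.lex (expo 0 1 0) one_ne_zero)
    (expo_ne_zero (by omega))
  have h4 := ne_zero_of_degree MonomialOrder.lex (f := chart (cf 4)) (e := expo 0 0 1)
    (by simpa [chart_cf] using degree_monomial_of_ne MonomialOrder.lex (expo 0 0 1) one_ne_zero)
    (expo_ne_zero (by omega))
  have h1 := ne_zero_of_degree MonomialOrder.lex (f := chart (cf 1)) (e := expo 1 1 0)
    (by
      rw [chart_cf]
      exact degree_add_monomial _ (degree_monomial_of_ne _ _ (inv_ne_zero (cc_ne_zero _)))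
        (expo_lt (by omega) (by omega) (by omega) (by omega)) _)
    (expo_ne_zero (by omega))
  have h3 := ne_zero_of_degree MonomialOrder.lex (f := chart (cf 3)) (e := expo 0 1 1)
    (by
      rw [chart_cf]
      exact degree_add_monomial _ (degree_monomial_of_ne _ _ (inv_ne_zero (cc_ne_zero _)))
        (expo_lt (by omega) (by omega) (by omega) (by omega)) _)
    (expo_ne_zero (by omega))
  have h5 := ne_zero_of_degree MonomialOrder.lex (f := chart (cf 5)) (e := expo 1 0 1)
    (by
      rw [chart_cf]
      exact degree_add_monomial _ (degree_monomial_of_ne _ _ (inv_ne_zero (cc_ne_zero _)))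
        (expo_lt (by omega) (by omega) (by omega) (by omega)) _)
    (expo_ne_zero (by omega))
  have hl := ne_zero_of_degree MonomialOrder.lex (f := chart (cf 12)) (e := expo 1 1 1)
    (by
      rw [chart_cf]
      refine degree_add_monomial _ (degree_add_monomial _ (degree_add_monomial _
        (degree_monomial_of_ne _ _ (by simp [cc_ne_zero])) ?_ _) ?_ _) ?_ _ <;>
      exact expo_lt (by omega) (by omega) (by omega) (by omega))
    (expo_ne_zero (by omega))
  simp only [stdMon, map_mul, map_pow]
  set k := min (e 0) (min (e 1) (e 2)) with hk
  set y1 := min (e 0) (e 1) - k with hy1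
  set y2 := min (e 1) (e 2) - k with hy2
  set y3 := min (e 2) (e 0) - k with hy3
  have key := degree_mul_pow _ (degree_mul_pow _ (degree_mul_pow _ (degree_mul_pow _
    (degree_mul_pow _ (degree_mul_pow _ (degree_mul_pow _
    (show (1 : MvPolynomial (Fin 3) CoeffField) ≠ 0 ∧ MonomialOrder.lex.degree
      (1 : MvPolynomial (Fin 3) CoeffField) = expo 0 0 0 from ⟨one_ne_zero, by
        rw [expo_zero, MonomialOrder.degree_one]⟩)
    h0 (e 0 - k - y1 - y3)) h2 (e 1 - k - y1 - y2)) h4 (e 2 - k - y2 - y3)) h1 y1) h3 y2) h5 y3) hl k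
  rw [one_mul] at key
  refine ⟨key.1, key.2.trans ?_⟩
  simp only [nsmul_expo, expo_add]
  conv_rhs => rw [← expo_eta e]
  congr 1 <;> omega

lemma chart_coeffHom (k : CoeffRing) :
    chart (coeffHom k) = algebraMap CoeffRing (MvPolynomial (Fin 3) CoeffField) k := by
  have h : (chart.comp coeffHom) = IsScalarTower.toAlgHom ℂ CoeffRing _ := by
    apply MvPolynomial.algHom_ext
    intro i
    have : algebraMap CoeffRing (MvPolynomial (Fin 3) CoeffField) (X i) = monomial 0 (cc i) := rfl
    simp only [AlgHom.comp_apply, IsScalarTower.coe_toAlgHom', this]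
    fin_cases i <;> simp [coeffHom, chart_cf, expo_zero]
  exact DFunLike.congr_fun h k

/-- The chart as a linear map over the coefficient ring. -/
noncomputable def chartLin : CoordRing →ₗ[CoeffRing] MvPolynomial (Fin 3) CoeffField where
  toFun := chart
  map_add' := map_add chart
  map_smul' k z := by
    rw [coeff_smul_def, map_mul, chart_coeffHom, RingHom.id_apply, Algebra.smul_def]

lemma linearIndependent_chart : LinearIndependent CoeffRing (chartLin ∘ stdMon) := by
  have h := linearIndependent_of_degree_eq MonomialOrder.lex (chartLin ∘ stdMon)
    (fun e => (chart_stdMon e).1) (fun e => (chart_stdMon e).2)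
  refine h.restrict_scalars ?_
  intro a b hab
  simpa [Algebra.smul_def] using hab

/-- The monomials `stdMon e` form a basis over the coefficient ring. -/
noncomputable def stdBasis : Module.Basis (Fin 3 →₀ ℕ) CoeffRing CoordRing :=
  Module.Basis.mk linearIndependent_chart.of_comp span_stdMon.ge

lemma chart_injective : Function.Injective chart := by
  rw [injective_iff_map_eq_zero]
  intro z hz
  have h := stdBasis.linearCombination_repr z
  have h2 := congrArg chartLin h
  rw [LinearMap.map_finsupp_linearCombination] at h2
  have h3 := (linearIndependent_iff.mp linearIndependent_chart) (stdBasis.repr z) (by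
    convert h2.trans hz using 2
    simp [stdBasis])
  rwa [LinearEquiv.map_eq_zero_iff] at h3

instance : IsDomain CoordRing := chart_injective.isDomain chart.toRingHom

lemma coeffHom_X_dvd {i j : Fin 6} (hij : i ≠ j) (m n : ℕ) (u v : CoordRing)
    (h : coeffHom (X i) ^ m * u = coeffHom (X j) ^ n * v) : coeffHom (X j) ^ n ∣ u := by
  rw [← map_pow, ← map_pow, ← coeff_smul_def, ← coeff_smul_def] at h
  rw [← stdBasis.linearCombination_repr u, Finsupp.linearCombination_apply, ← map_pow]
  refine Finset.dvd_sum fun e _ => ?_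
  have he := DFunLike.congr_fun (congrArg stdBasis.repr h) e
  simp only [map_smul, Finsupp.smul_apply, smul_eq_mul] at he
  have hp : Prime (X j : CoeffRing) := MvPolynomial.X_prime
  have : X j ^ n ∣ stdBasis.repr u e := by
    refine hp.pow_dvd_of_dvd_mul_left n (fun hd => ?_) (Dvd.intro _ he.symm)
    exact hij ((X_dvd_X.mp (hp.dvd_of_dvd_pow hd)).symm)
  exact Dvd.dvd.mul_right (map_dvd coeffHom this) (stdBasis e)

lemma cf_b_ne_zero (i : Fin 13) (hi : i = 7 ∨ i = 9 ∨ i = 11) : cf i ≠ 0 := by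
  intro h
  have h' := chart_cf i
  rw [h, map_zero] at h'
  rcases hi with rfl | rfl | rfl <;> exact cc_ne_zero _ (by simpa using h'.symm)

/-- The cyclic rotation of the variety, as an endomorphism of its coordinate ring. -/
noncomputable def rotHom : CoordRing →ₐ[ℂ] CoordRing :=
  pointHom (cf 2) (cf 4) (cf 0) (cf 3) (cf 5) (cf 1) (cf 8) (cf 10) (cf 6) (cf 9) (cf 11) (cf 7)
    (cf 12) (cf_b_ne_zero 9 (by simp)) (cf_b_ne_zero 11 (by simp)) (cf_b_ne_zero 7 (by simp))
    (by linear_combination -cf_rel12) (by linear_combination -cf_rel13)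
    (by linear_combination -cf_rel11)
    (by linear_combination -cf 9 * cf_rel31 - cf 0 * cf_rel12)

lemma rotHom_cf (i : Fin 13) : rotHom (cf i) =
    ![cf 2, cf 3, cf 4, cf 5, cf 0, cf 1, cf 8, cf 9, cf 10, cf 11, cf 6, cf 7, cf 12] i :=
  pointHom_cf ..

lemma rotHom_rotHom_rotHom (z : CoordRing) : rotHom (rotHom (rotHom z)) = z := by
  induction z using coordRing_induction with
  | hC c => simp only [AlgHom.commutes]
  | hadd u v hu hv => simp only [map_add, hu, hv]
  | hmul u i hu =>
    rw [map_mul, map_mul, map_mul, hu]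
    congr 1
    fin_cases i <;> simp [rotHom_cf]

lemma rotHom_bijective : Function.Bijective rotHom :=
  ⟨fun u v h => by rw [← rotHom_rotHom_rotHom u, h, rotHom_rotHom_rotHom],
    fun z => ⟨_, rotHom_rotHom_rotHom z⟩⟩

/-- The affine coordinates `θ₁, θ₂, θ₃, θ₂₃, A₂, A₃, A₁₂, A₂₃, A₃₁` on the open subset
`A₁₂ A₃₁ ≠ 0` of the variety. -/
noncomputable def affineHom : MvPolynomial (Fin 9) ℂ →ₐ[ℂ] CoordRing :=
  aeval ![cf 0, cf 2, cf 4, cf 3, cf 8, cf 10, cf 7, cf 9, cf 11]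

/-- The coordinate functions as rational functions in the affine coordinates. -/
noncomputable def ac (i : Fin 9) : FractionRing (MvPolynomial (Fin 9) ℂ) :=
  algebraMap (MvPolynomial (Fin 9) ℂ) _ (X i)

lemma ac_ne_zero (i : Fin 9) : ac i ≠ 0 := by
  rw [ac, map_ne_zero_iff _ (IsFractionRing.injective (MvPolynomial (Fin 9) ℂ) _)]
  exact X_ne_zero i

lemma affineHom_injective : Function.Injective affineHom := by
  have h6 := ac_ne_zero 6
  have h7 := ac_ne_zero 7
  have h8 := ac_ne_zero 8
  let δ : CoordRing →ₐ[ℂ] FractionRing (MvPolynomial (Fin 9) ℂ) :=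
    pointHom (ac 0) (ac 1) (ac 2) ((ac 0 * ac 1 - ac 5 * ac 7 * ac 8) / ac 6) (ac 3)
      ((ac 2 * ac 0 - ac 4 * ac 6 * ac 7) / ac 8) ((ac 1 * ac 2 - ac 7 * ac 3) / (ac 8 * ac 6))
      (ac 4) (ac 5) (ac 6) (ac 7) (ac 8)
      ((ac 0 * ac 3 - ac 6 * ac 4 * ac 1 - ac 5 * ac 8 * ac 2) / (ac 8 * ac 6)) h6 h7 h8
      (by field_simp) (by field_simp; ring) (by field_simp) (by field_simp; ring)
  have hδ : δ.comp affineHom = IsScalarTower.toAlgHom ℂ (MvPolynomial (Fin 9) ℂ) _ := by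
    apply MvPolynomial.algHom_ext
    intro i
    have : algebraMap (MvPolynomial (Fin 9) ℂ)
      (FractionRing (MvPolynomial (Fin 9) ℂ)) (X i) = ac i := rfl
    simp only [AlgHom.comp_apply, IsScalarTower.coe_toAlgHom', this, δ]
    fin_cases i <;> simp [affineHom, pointHom_cf]
  have hinj : Function.Injective (δ.comp affineHom) := by
    rw [hδ]
    exact IsFractionRing.injective (MvPolynomial (Fin 9) ℂ) _
  exact Function.Injective.of_comp hinj

lemma affineHom_surj (z : CoordRing) : ∃ (n : ℕ) (c : MvPolynomial (Fin 9) ℂ),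
    affineHom (X 8 * X 6) ^ n * z = affineHom c := by
  have hgen : ∀ i, ∃ c : MvPolynomial (Fin 9) ℂ, affineHom (X 8 * X 6) * cf i = affineHom c := by
    have hself : ∀ i j, affineHom (X j) = cf i →
        ∃ c : MvPolynomial (Fin 9) ℂ, affineHom (X 8 * X 6) * cf i = affineHom c :=
      fun i j h => ⟨X 8 * X 6 * X j, by rw [map_mul affineHom (X 8 * X 6), h]⟩
    intro i
    fin_cases i
    · exact hself 0 0 (by simp [affineHom])
    · refine ⟨X 8 * (X 0 * X 1 - X 7 * X 5 * X 8), ?_⟩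
      simp [affineHom]
      linear_combination -cf 11 * cf_rel11
    · exact hself 2 1 (by simp [affineHom])
    · exact hself 3 3 (by simp [affineHom])
    · exact hself 4 2 (by simp [affineHom])
    · refine ⟨X 6 * (X 2 * X 0 - X 6 * X 4 * X 7), ?_⟩
      simp [affineHom]
      linear_combination -cf 7 * cf_rel13
    · refine ⟨X 1 * X 2 - X 7 * X 3, ?_⟩
      simp [affineHom]
      linear_combination -cf_rel12
    · exact hself 7 6 (by simp [affineHom])
    · exact hself 8 4 (by simp [affineHom])
    · exact hself 9 7 (by simp [affineHom])
    · exact hself 10 5 (by simp [affineHom])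
    · exact hself 11 8 (by simp [affineHom])
    · refine ⟨X 0 * X 3 - X 6 * X 4 * X 1 - X 5 * X 8 * X 2, ?_⟩
      simp [affineHom]
      linear_combination -cf_rel31
  induction z using coordRing_induction with
  | hC c => exact ⟨0, algebraMap ℂ _ c, by simp⟩
  | hadd u v hu hv =>
    obtain ⟨n, c, hc⟩ := hu
    obtain ⟨m, d, hd⟩ := hv
    refine ⟨n + m, (X 8 * X 6) ^ m * c + (X 8 * X 6) ^ n * d, ?_⟩
    rw [map_add, map_mul affineHom (_ ^ m), map_mul affineHom (_ ^ n), ← hc, ← hd,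
      map_pow affineHom _ m, map_pow affineHom _ n]
    ring
  | hmul u i hu =>
    obtain ⟨n, c, hc⟩ := hu
    obtain ⟨d, hd⟩ := hgen i
    refine ⟨n + 1, c * d, ?_⟩
    rw [map_mul affineHom c, ← hc, ← hd]
    ring

lemma exists_multiple_mem_rot (ρ : CoordRing →ₐ[ℂ] CoordRing) (hρ : Function.Bijective ρ)
    (f : FractionRing CoordRing) (hf : IsIntegral CoordRing f) :
    ∃ (n : ℕ) (u : CoordRing), algebraMap CoordRing (FractionRing CoordRing)
      (ρ (cf 11 * cf 7) ^ n) * f = algebraMap _ _ u := by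
  have h := exists_multiple_mem (ρ.comp affineHom : MvPolynomial (Fin 9) ℂ →+* CoordRing)
    (hρ.1.comp affineHom_injective) (X 8 * X 6) (mul_ne_zero (X_ne_zero _) (X_ne_zero _))
    (fun z => by
      obtain ⟨w, rfl⟩ := hρ.2 z
      obtain ⟨n, c, hc⟩ := affineHom_surj w
      refine ⟨n, c, ?_⟩
      simpa using congrArg ρ hc) f hf
  simpa [affineHom] using h

instance : IsIntegrallyClosed CoordRing := by
  have hX : ∀ i : Fin 3, coeffHom (X (![3, 4, 5] i)) = ![cf 7, cf 9, cf 11] i := by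
    intro i; fin_cases i <;> simp [coeffHom]
  refine isIntegrallyClosed_of_regular ![cf 7, cf 9, cf 11] ?_ ?_ ?_
  · intro i
    fin_cases i <;> exact cf_b_ne_zero _ (by simp)
  · intro i j hij u v m n h
    rw [← hX i, ← hX j] at h
    rw [← hX j]
    refine coeffHom_X_dvd ?_ m n u v h
    revert hij
    fin_cases i <;> fin_cases j <;> simp
  · intro i f hf
    fin_cases i
    · simpa [rotHom_cf] using exists_multiple_mem_rot rotHom rotHom_bijective f hf
    · simpa [rotHom_cf] using exists_multiple_mem_rot (rotHom.comp rotHom)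
        (rotHom_bijective.comp rotHom_bijective) f hf
    · simpa using exists_multiple_mem_rot (AlgHom.id ℂ CoordRing) Function.bijective_id f hf

/-- The coordinate ring `R13 ⧸ IC2` of the C₂ cluster variety is a normal
domain: an integral domain which is integrally closed in its field of fractions. -/
theorem IC2_quotient_normal :
    IsDomain (R13 ⧸ IC2) ∧ IsIntegrallyClosed (R13 ⧸ IC2) :=
  ⟨inferInstanceAs (IsDomain CoordRing), inferInstanceAs (IsIntegrallyClosed CoordRing)⟩
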